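/- Suppose A is Γ-graded D-simple. Then A[D] is a free left A-module with homogeneous basis {d^α | α ∈ 𝒥}, i.e. A[D] = ⊕_{α∈𝒥} A d^α and each d^α is nonzero with ad^α = 0 (a ∈ A) only when a = 0. -/

import Mathlib

/-- A skew-symmetric bicharacter `ε : Γ × Γ → F^×`. -/
def IsBichar {F : Type} [Field F] {Γ : Type} [AddCommGroup Γ] (ε : Γ → Γ → F) : Prop :=
  (∀ lam mu, ε lam mu * ε mu lam = 1) ∧
  (∀ lam mu nu, ε lam (mu + nu) = ε lam mu * ε lam nu)

variable (F : Type) [Field F] (Γ : Type) [AddCommGroup Γ] [DecidableEq Γ]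
  (A : Type) [Ring A] [Algebra F A]

/-- left multiplication operators -/
noncomputable def mulL : A →ₗ[F] Module.End F A := (Algebra.lmul F A).toLinearMap

variable {F Γ A}

/-- `f ∈ End_F(A)` is homogeneous of degree `δ`. -/
def IsHomogMap (𝒜 : Γ → Submodule F A) (δ : Γ) (f : Module.End F A) : Prop :=
  ∀ lam : Γ, ∀ a ∈ 𝒜 lam, f a ∈ 𝒜 (lam + δ)

/-- `f` is a homogeneous color-derivation of degree `δ`. -/
def IsColorDer (𝒜 : Γ → Submodule F A) (ε : Γ → Γ → F) (δ : Γ) (f : Module.End F A) : Prop :=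
  IsHomogMap 𝒜 δ f ∧
  ∀ lam : Γ, ∀ a ∈ 𝒜 lam, ∀ b : A, f (a * b) = f a * b + ε δ lam • (a * f b)

/-- `Der^ε(A)`: the F-span of homogeneous color derivations. -/
def DerE (𝒜 : Γ → Submodule F A) (ε : Γ → Γ → F) : Submodule F (Module.End F A) :=
  Submodule.span F {f | ∃ δ, IsColorDer 𝒜 ε δ f}

/-- `A` is ε-commutative. -/
def IsColorComm (𝒜 : Γ → Submodule F A) (ε : Γ → Γ → F) : Prop :=
  ∀ lam mu : Γ, ∀ a ∈ 𝒜 lam, ∀ b ∈ 𝒜 mu, a * b = ε lam mu • (b * a)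

/-- `D` is color-commutative. -/
def DColorComm (𝒜 : Γ → Submodule F A) (ε : Γ → Γ → F) (D : Submodule F (Module.End F A)) : Prop :=
  ∀ δ δ' f g, f ∈ D → g ∈ D → IsColorDer 𝒜 ε δ f → IsColorDer 𝒜 ε δ' g →
    f * g = ε δ δ' • (g * f)

/-- `D` is a Γ-graded subspace: it is spanned by its homogeneous color-derivations. -/
def DGraded (𝒜 : Γ → Submodule F A) (ε : Γ → Γ → F) (D : Submodule F (Module.End F A)) : Prop :=
  D = Submodule.span F {f | f ∈ D ∧ ∃ δ, IsColorDer 𝒜 ε δ f}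

/-- `A[D]`: the unital subalgebra of `End_F(A)` generated by left multiplications and `D`. -/
noncomputable def AD (D : Submodule F (Module.End F A)) : Subalgebra F (Module.End F A) :=
  Algebra.adjoin F (Set.range (mulL F A) ∪ (D : Set (Module.End F A)))

/-- `A` is Γ-graded `D`-simple. -/
def GradedDSimple (𝒜 : Γ → Submodule F A) [GradedAlgebra 𝒜] (D : Submodule F (Module.End F A)) :
    Prop :=
  ∀ I : Ideal A, Ideal.IsHomogeneous 𝒜 I → (∀ f ∈ D, ∀ x ∈ I, f x ∈ I) → I = ⊥ ∨ I = ⊤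

/-- F₁ = A^D -/
def F1 (D : Submodule F (Module.End F A)) : Submodule F A where
  carrier := {u | ∀ f ∈ D, f u = 0}
  add_mem' := by
    intro a b ha hb f hf
    rw [map_add, ha f hf, hb f hf, add_zero]
  zero_mem' := by intro f hf; exact map_zero f
  smul_mem' := by
    intro c x hx f hf
    rw [map_smul, hx f hf, smul_zero]

/-- the derived space `W = [A[D], A[D]]`. -/
def Wsub (𝒜 : Γ → Submodule F A) (ε : Γ → Γ → F) (D : Submodule F (Module.End F A)) :
    Submodule F (Module.End F A) :=
  Submodule.span F {w | ∃ γ γ' x y, x ∈ AD D ∧ y ∈ AD D ∧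
    IsHomogMap 𝒜 γ x ∧ IsHomogMap 𝒜 γ' y ∧ w = x * y - ε γ γ' • (y * x)}

/-- `F₁[D]`. -/
noncomputable def F1D (D : Submodule F (Module.End F A)) : Subalgebra F (Module.End F A) :=
  Algebra.adjoin F ((mulL F A '' (F1 D : Set A)) ∪ (D : Set (Module.End F A)))

/-- `𝒟 = Der^ε(A) ∩ F₁[D]`. -/
def DScr (𝒜 : Γ → Submodule F A) (ε : Γ → Γ → F) (D : Submodule F (Module.End F A)) :
    Set (Module.End F A) :=
  {f | f ∈ F1D D ∧ f ∈ DerE 𝒜 ε}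

variable {I : Type} [LinearOrder I]

/-- ordered product `d^α`. -/
noncomputable def dpow (d : I → Module.End F A) (α : I →₀ ℕ) : Module.End F A :=
  ((α.support.sort (· ≤ ·)).map fun i => d i ^ α i).prod

/-- membership in the index set 𝒥. -/
def inJ (ε : Γ → Γ → F) (δd : I → Γ) (α : I →₀ ℕ) : Prop :=
  (∀ i, ringChar F ≠ 0 → α i ≤ ringChar F - 1) ∧
  (∀ i, ε (δd i) (δd i) = -1 → α i ≤ 1)

/-- the degree of `d^α`. -/
def degJ (δd : I → Γ) (α : I →₀ ℕ) : Γ := α.sum fun i n => n • δd i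

/-- the subalgebra `S` of `End_F(A)` is Γ-graded simple. -/
def GradedSimpleAlgOn (𝒜 : Γ → Submodule F A) (S : Subalgebra F (Module.End F A)) : Prop :=
  ∀ L : Submodule F (Module.End F A),
    L ≤ Subalgebra.toSubmodule S →
    (∀ x ∈ S, ∀ y ∈ L, x * y ∈ L ∧ y * x ∈ L) →
    L = Submodule.span F {f | f ∈ L ∧ ∃ δ, IsHomogMap 𝒜 δ f} →
    (L = ⊥ ∨ L = Subalgebra.toSubmodule S)

/-- variant of 𝒥 without characteristic restriction -/
def inJ0 (ε : Γ → Γ → F) (δd : I → Γ) (α : I →₀ ℕ) : Prop :=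
  ∀ i, ε (δd i) (δd i) = -1 → α i ≤ 1

/-- the sum `Σ_{α ∈ J0} B d^α` is direct -/
def DirectOn (d : I → Module.End F A) (J0 : Set (I →₀ ℕ)) (Bs : Set A) : Prop :=
  ∀ (s : Finset (I →₀ ℕ)) (c : (I →₀ ℕ) → A), ↑s ⊆ J0 → (∀ α ∈ s, c α ∈ Bs) →
    (∑ α ∈ s, mulL F A (c α) * dpow d α) = 0 → ∀ α ∈ s, mulL F A (c α) * dpow d α = 0

/-- span of color brackets of homogeneous elements of `M` and `N` -/
def brkE (𝒜 : Γ → Submodule F A) (ε : Γ → Γ → F) (M N : Submodule F (Module.End F A)) :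
    Submodule F (Module.End F A) :=
  Submodule.span F {w | ∃ γ γ' x y, x ∈ M ∧ y ∈ N ∧
    IsHomogMap 𝒜 γ x ∧ IsHomogMap 𝒜 γ' y ∧ w = x * y - ε γ γ' • (y * x)}

set_option linter.unusedSectionVars false

/-! ### Skew-symmetric bicharacters -/

theorem IsBichar.ne_zero {ε : Γ → Γ → F} (h : IsBichar ε) (a b : Γ) : ε a b ≠ 0 :=
  left_ne_zero_of_mul_eq_one (h.1 a b)

theorem IsBichar.add_left {ε : Γ → Γ → F} (h : IsBichar ε) (a b c : Γ) :
    ε (a + b) c = ε a c * ε b c := by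
  have key : ε c (a + b) ≠ 0 := h.ne_zero _ _
  apply mul_right_cancel₀ key
  rw [h.1, h.2]
  linear_combination (-ε b c * ε c b) * h.1 a c - h.1 b c

theorem IsBichar.zero_right {ε : Γ → Γ → F} (h : IsBichar ε) (a : Γ) : ε a 0 = 1 := by
  have := h.2 a 0 0
  rw [add_zero] at this
  exact (mul_eq_left₀ (h.ne_zero a 0)).1 this.symm

theorem IsBichar.zero_left {ε : Γ → Γ → F} (h : IsBichar ε) (a : Γ) : ε 0 a = 1 := by
  have := h.1 0 a
  rwa [h.zero_right, mul_one] at this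

theorem IsBichar.nsmul_left {ε : Γ → Γ → F} (h : IsBichar ε) (n : ℕ) (a b : Γ) :
    ε (n • a) b = ε a b ^ n := by
  induction n with
  | zero => simp [h.zero_left]
  | succ n ih => rw [succ_nsmul, h.add_left, ih, pow_succ]

theorem IsBichar.self_eq_one_or {ε : Γ → Γ → F} (h : IsBichar ε) (a : Γ) :
    ε a a = 1 ∨ ε a a = -1 :=
  mul_self_eq_one_iff.1 (h.1 a a)

/-! ### Homogeneous maps -/

theorem mulL_apply (a b : A) : mulL F A a b = a * b := rfl

theorem mulL_mul (a b : A) : mulL F A (a * b) = mulL F A a * mulL F A b :=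
  map_mul (Algebra.lmul F A) a b

theorem mulL_one : mulL F A 1 = 1 := map_one (Algebra.lmul F A)

theorem mulL_injective {a : A} (h : mulL F A a = 0) : a = 0 := by
  simpa [mulL_apply] using LinearMap.congr_fun h 1

theorem end_ext_homogeneous (𝒜 : Γ → Submodule F A) [GradedAlgebra 𝒜] {f g : Module.End F A}
    (h : ∀ lam, ∀ a ∈ 𝒜 lam, f a = g a) : f = g := by
  ext a
  induction a using DirectSum.Decomposition.inductionOn 𝒜 with
  | zero => simp
  | homogeneous a => exact h _ _ a.2
  | add a b ha hb => rw [map_add, map_add, ha, hb]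

theorem IsHomogMap.decompose_apply {𝒜 : Γ → Submodule F A} [GradedAlgebra 𝒜] {δ : Γ}
    {f : Module.End F A} (hf : IsHomogMap 𝒜 δ f) (a : A) (lam : Γ) :
    (DirectSum.decompose 𝒜 (f a) (lam + δ) : A) = f (DirectSum.decompose 𝒜 a lam) := by
  induction a using DirectSum.Decomposition.inductionOn 𝒜 with
  | zero => simp
  | @homogeneous mu a =>
    by_cases h : mu = lam
    · subst h
      rw [DirectSum.decompose_of_mem_same _ a.2, DirectSum.decompose_of_mem_same _ (hf _ _ a.2)]
    · rw [DirectSum.decompose_of_mem_ne _ a.2 h, map_zero,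
        DirectSum.decompose_of_mem_ne _ (hf _ _ a.2) (by simpa using h)]
  | add a b ha hb =>
    simp only [map_add, DirectSum.decompose_add, DirectSum.add_apply, Submodule.coe_add, ha, hb]

theorem isHomogMap_mulL {𝒜 : Γ → Submodule F A} [GradedAlgebra 𝒜] {lam : Γ} {a : A}
    (ha : a ∈ 𝒜 lam) : IsHomogMap 𝒜 lam (mulL F A a) := fun mu b hb => by
  rw [add_comm mu lam]
  exact SetLike.mul_mem_graded ha hb

theorem IsHomogMap.mul {𝒜 : Γ → Submodule F A} {δ δ' : Γ} {f g : Module.End F A}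
    (hf : IsHomogMap 𝒜 δ f) (hg : IsHomogMap 𝒜 δ' g) : IsHomogMap 𝒜 (δ + δ') (f * g) :=
  fun lam a ha => by
    have := hf _ _ (hg _ _ ha)
    rwa [add_assoc, add_comm δ' δ] at this

theorem isHomogMap_one (𝒜 : Γ → Submodule F A) : IsHomogMap 𝒜 0 (1 : Module.End F A) :=
  fun lam a ha => by rwa [add_zero]

theorem IsHomogMap.pow {𝒜 : Γ → Submodule F A} {δ : Γ} {f : Module.End F A}
    (hf : IsHomogMap 𝒜 δ f) (n : ℕ) : IsHomogMap 𝒜 (n • δ) (f ^ n) := by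
  induction n with
  | zero => simpa using isHomogMap_one 𝒜
  | succ n ih => rw [pow_succ, succ_nsmul]; exact ih.mul hf

theorem IsColorDer.apply_one {𝒜 : Γ → Submodule F A} [GradedAlgebra 𝒜] {ε : Γ → Γ → F}
    (hε : IsBichar ε) {δ : Γ} {f : Module.End F A} (hf : IsColorDer 𝒜 ε δ f) : f 1 = 0 := by
  have := hf.2 0 1 SetLike.GradedOne.one_mem 1
  simpa [hε.zero_right] using this

theorem IsColorDer.mul_mulL {𝒜 : Γ → Submodule F A} {ε : Γ → Γ → F} {δ : Γ}
    {f : Module.End F A} (hf : IsColorDer 𝒜 ε δ f) {lam : Γ} {a : A} (ha : a ∈ 𝒜 lam) :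
    f * mulL F A a = mulL F A (f a) + ε δ lam • (mulL F A a * f) := by
  ext b
  simpa [mulL_apply] using hf.2 lam a ha b

/-! ### Color-commutation in `F₁[D]` -/

/-- The diagonal operator acting on degree `lam` as the scalar `ε lam mu`. -/
noncomputable def colorTwist (𝒜 : Γ → Submodule F A) [GradedAlgebra 𝒜] (ε : Γ → Γ → F) (mu : Γ) :
    Module.End F A :=
  DirectSum.toModule F Γ A (fun lam => ε lam mu • (𝒜 lam).subtype) ∘ₗ
    (DirectSum.decomposeLinearEquiv 𝒜).toLinearMap

theorem colorTwist_apply {𝒜 : Γ → Submodule F A} [GradedAlgebra 𝒜] (ε : Γ → Γ → F) (mu : Γ)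
    {lam : Γ} {a : A} (ha : a ∈ 𝒜 lam) : colorTwist 𝒜 ε mu a = ε lam mu • a := by
  lift a to 𝒜 lam using ha
  simp [colorTwist]

theorem commute_colorTwist_mul_iff {𝒜 : Γ → Submodule F A} [GradedAlgebra 𝒜] {ε : Γ → Γ → F}
    (hε : IsBichar ε) {δ δ' : Γ} {f g : Module.End F A} (hf : IsHomogMap 𝒜 δ f)
    (hg : IsHomogMap 𝒜 δ' g) :
    Commute (colorTwist 𝒜 ε δ' * g) f ↔ f * g = ε δ δ' • (g * f) := by
  have key : ∀ lam, ∀ a ∈ 𝒜 lam,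
      ((colorTwist 𝒜 ε δ' * g * f) a = (f * (colorTwist 𝒜 ε δ' * g)) a ↔
        (f * g) a = (ε δ δ' • (g * f)) a) := by
    intro lam a ha
    simp only [Module.End.mul_apply, LinearMap.smul_apply]
    rw [colorTwist_apply ε δ' (hg _ _ (hf _ _ ha)), colorTwist_apply ε δ' (hg _ _ ha), map_smul]
    have e : ε (lam + δ + δ') δ' = ε (lam + δ') δ' * ε δ δ' := by
      simp only [hε.add_left]; ring
    rw [e, mul_smul, (smul_right_injective A (hε.ne_zero (lam + δ') δ')).eq_iff, eq_comm]
  exact ⟨fun h => end_ext_homogeneous 𝒜 fun lam a ha =>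
      (key lam a ha).1 (LinearMap.congr_fun h.eq a),
    fun h => end_ext_homogeneous 𝒜 fun lam a ha => (key lam a ha).2 (LinearMap.congr_fun h a)⟩

theorem F1_decompose_mem {𝒜 : Γ → Submodule F A} [GradedAlgebra 𝒜] {ε : Γ → Γ → F}
    {D : Submodule F (Module.End F A)} (hDgr : DGraded 𝒜 ε D) {u : A} (hu : u ∈ F1 D) (lam : Γ) :
    (DirectSum.decompose 𝒜 u lam : A) ∈ F1 D := by
  intro f hf
  rw [hDgr] at hf
  induction hf using Submodule.span_induction with
  | mem f hf =>
    obtain ⟨hf, δ, hδ⟩ := hf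
    rw [← hδ.1.decompose_apply, hu f hf]
    simp
  | zero => simp
  | add f g _ _ hf hg => rw [LinearMap.add_apply, hf, hg, add_zero]
  | smul c f _ hf => rw [LinearMap.smul_apply, hf, smul_zero]

/-- `f` is a homogeneous generator of degree `δ` of the algebra `F₁[D]`. -/
def IsHomogGen (𝒜 : Γ → Submodule F A) (ε : Γ → Γ → F) (D : Submodule F (Module.End F A))
    (δ : Γ) (f : Module.End F A) : Prop :=
  (f ∈ D ∧ IsColorDer 𝒜 ε δ f) ∨ ∃ u ∈ F1 D, u ∈ 𝒜 δ ∧ f = mulL F A u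

theorem IsHomogGen.isHomogMap {𝒜 : Γ → Submodule F A} [GradedAlgebra 𝒜] {ε : Γ → Γ → F}
    {D : Submodule F (Module.End F A)} {δ : Γ} {f : Module.End F A}
    (hf : IsHomogGen 𝒜 ε D δ f) : IsHomogMap 𝒜 δ f := by
  obtain ⟨-, hf⟩ | ⟨u, -, hu, rfl⟩ := hf
  · exact hf.1
  · exact isHomogMap_mulL hu

theorem IsHomogGen.mul_comm {𝒜 : Γ → Submodule F A} [GradedAlgebra 𝒜] {ε : Γ → Γ → F}
    (hε : IsBichar ε) (hcomm : IsColorComm 𝒜 ε) {D : Submodule F (Module.End F A)}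
    (hDcc : DColorComm 𝒜 ε D) {δ δ' : Γ} {f g : Module.End F A}
    (hf : IsHomogGen 𝒜 ε D δ f) (hg : IsHomogGen 𝒜 ε D δ' g) :
    f * g = ε δ δ' • (g * f) := by
  obtain ⟨hfD, hf⟩ | ⟨u, hu, huδ, rfl⟩ := hf <;> obtain ⟨hgD, hg⟩ | ⟨v, hv, hvδ, rfl⟩ := hg
  · exact hDcc _ _ _ _ hfD hgD hf hg
  · rw [hf.mul_mulL hvδ, hv f hfD, map_zero, zero_add]
  · rw [hg.mul_mulL huδ, hu g hgD, map_zero, zero_add, smul_smul, hε.1, one_smul]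
  · rw [← mulL_mul, ← mulL_mul, ← map_smul, hcomm _ _ _ huδ _ hvδ]

theorem commute_F1D {𝒜 : Γ → Submodule F A} [GradedAlgebra 𝒜] {ε : Γ → Γ → F}
    {D : Submodule F (Module.End F A)} (hDgr : DGraded 𝒜 ε D) {h : Module.End F A}
    (hgen : ∀ δ f, IsHomogGen 𝒜 ε D δ f → Commute h f) {f : Module.End F A} (hf : f ∈ F1D D) :
    Commute h f := by
  induction hf using Algebra.adjoin_induction with
  | mem f hf =>
    obtain ⟨u, hu, rfl⟩ | hf := hf
    · classical
      rw [← DirectSum.sum_support_decompose 𝒜 u, map_sum]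
      exact Commute.sum_right _ _ _ fun lam _ =>
        hgen lam _ (Or.inr ⟨_, F1_decompose_mem hDgr hu lam, SetLike.coe_mem _, rfl⟩)
    · rw [SetLike.mem_coe, hDgr] at hf
      induction hf using Submodule.span_induction with
      | mem f hf =>
        obtain ⟨hf, δ, hδ⟩ := hf
        exact hgen δ f (Or.inl ⟨hf, hδ⟩)
      | zero => exact Commute.zero_right _
      | add f g _ _ hf hg => exact hf.add_right hg
      | smul c f _ hf => exact hf.smul_right c
  | algebraMap r => exact (Algebra.commutes r h).symm
  | add f g _ _ hf hg => exact hf.add_right hg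
  | mul f g _ _ hf hg => exact hf.mul_right hg

theorem F1D_mul_gen_comm {𝒜 : Γ → Submodule F A} [GradedAlgebra 𝒜] {ε : Γ → Γ → F}
    (hε : IsBichar ε) (hcomm : IsColorComm 𝒜 ε) {D : Submodule F (Module.End F A)}
    (hDgr : DGraded 𝒜 ε D) (hDcc : DColorComm 𝒜 ε D) {δ δ' : Γ} {f g : Module.End F A}
    (hf : f ∈ F1D D) (hfδ : IsHomogMap 𝒜 δ f) (hg : IsHomogGen 𝒜 ε D δ' g) :
    f * g = ε δ δ' • (g * f) :=
  (commute_colorTwist_mul_iff hε hfδ hg.isHomogMap).1 <| commute_F1D hDgr (fun _ _ hk =>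
    (commute_colorTwist_mul_iff hε hk.isHomogMap hg.isHomogMap).2 (hk.mul_comm hε hcomm hDcc hg)) hf

theorem F1D_mul_comm {𝒜 : Γ → Submodule F A} [GradedAlgebra 𝒜] {ε : Γ → Γ → F}
    (hε : IsBichar ε) (hcomm : IsColorComm 𝒜 ε) {D : Submodule F (Module.End F A)}
    (hDgr : DGraded 𝒜 ε D) (hDcc : DColorComm 𝒜 ε D) {δ δ' : Γ} {f g : Module.End F A}
    (hf : f ∈ F1D D) (hfδ : IsHomogMap 𝒜 δ f) (hg : g ∈ F1D D) (hgδ : IsHomogMap 𝒜 δ' g) :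
    f * g = ε δ δ' • (g * f) := by
  refine (commute_colorTwist_mul_iff hε hfδ hgδ).1 <| commute_F1D hDgr (fun δk k hk =>
    (commute_colorTwist_mul_iff hε hk.isHomogMap hgδ).2 ?_) hf
  rw [F1D_mul_gen_comm hε hcomm hDgr hDcc hg hgδ hk, smul_smul, hε.1, one_smul]

/-! ### The `p`-th power of an even color-derivation -/

theorem IsColorDer.pow_prime {𝒜 : Γ → Submodule F A} [GradedAlgebra 𝒜] [Nontrivial A]
    {ε : Γ → Γ → F} (hε : IsBichar ε) {δ : Γ} {f : Module.End F A} (hf : IsColorDer 𝒜 ε δ f)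
    (heven : ε δ δ = 1) (p : ℕ) [Fact p.Prime] [CharP F p] :
    IsColorDer 𝒜 ε (p • δ) (f ^ p) := by
  refine ⟨hf.1.pow p, ?_⟩
  set R : A → Module.End F A := fun b => (LinearMap.mul F A).flip b with hR
  set τ : Module.End F A := colorTwist 𝒜 (fun a b => ε b a) δ with hτ
  have hτa : ∀ lam, ∀ a ∈ 𝒜 lam, τ a = ε δ lam • a := fun lam a ha => colorTwist_apply _ _ ha
  have hτf : τ * f = f * τ := end_ext_homogeneous 𝒜 fun lam a ha => by
    rw [Module.End.mul_apply, Module.End.mul_apply, hτa _ _ ha, hτa _ _ (hf.1 _ _ ha), map_smul,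
      hε.2, heven, mul_one]
  set X : Module.End F (Module.End F A) := LinearMap.mulLeft F f with hX
  set Y : Module.End F (Module.End F A) := LinearMap.mulRight F f with hY
  have hXY : Commute X Y := LinearMap.commute_mulLeft_right f f
  have hbase : ∀ b, f * R b - R b * f = R (f b) * τ := fun b =>
    end_ext_homogeneous 𝒜 fun lam a ha => by
      simp [hR, hτa _ _ ha, hf.2 _ a ha b]
  have had : ∀ n b, ((X - Y) ^ n) (R b) = R ((f ^ n) b) * τ ^ n := by
    intro n b
    induction n with
    | zero => simp
    | succ n ih =>
      have hc : τ ^ n * f = f * τ ^ n := Commute.pow_left hτf n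
      rw [pow_succ', Module.End.mul_apply, ih, pow_succ' f, Module.End.mul_apply, pow_succ' τ,
        ← mul_assoc, ← hbase]
      simp only [hX, hY, LinearMap.sub_apply, LinearMap.mulLeft_apply, LinearMap.mulRight_apply,
        sub_mul, mul_assoc, hc]
  have : CharP (Module.End F (Module.End F A)) p :=
    charP_of_injective_algebraMap (algebraMap F (Module.End F (Module.End F A))).injective p
  intro lam a ha b
  have h := had p b
  have hsub : (X - Y) ^ p = X ^ p - Y ^ p :=
    sub_pow_char_of_commute (R := Module.End F (Module.End F A)) p hXY
  rw [hsub, hX, hY, LinearMap.pow_mulLeft, LinearMap.pow_mulRight] at h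
  have h' := LinearMap.congr_fun h a
  have hτp : ∀ n, (τ ^ n) a = ε δ lam ^ n • a := by
    intro n
    induction n with
    | zero => simp
    | succ n ih => rw [pow_succ', Module.End.mul_apply, ih, map_smul, hτa _ _ ha, smul_smul, pow_succ]
  simp [hR, hτp] at h'
  rw [hε.nsmul_left]
  rw [sub_eq_iff_eq_add] at h'
  rw [h', add_comm]

/-! ### Linear independence over `A` of color-derivations -/

theorem sum_mulL_mul_component {𝒜 : Γ → Submodule F A} [GradedAlgebra 𝒜] {d : I → Module.End F A}
    {δd : I → Γ} (hd : ∀ i, IsHomogMap 𝒜 (δd i) (d i)) {s : Finset I} {c : I → A}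
    (h : ∑ i ∈ s, mulL F A (c i) * d i = 0) (γ : Γ) :
    ∑ i ∈ s, mulL F A (DirectSum.decompose 𝒜 (c i) (γ - δd i)) * d i = 0 := by
  refine end_ext_homogeneous 𝒜 fun lam b hb => ?_
  have h' := congrArg (fun x => (DirectSum.decompose 𝒜 x (lam + γ) : A)) (LinearMap.congr_fun h b)
  simp only [LinearMap.sum_apply, Module.End.mul_apply, mulL_apply, LinearMap.zero_apply,
    DirectSum.decompose_sum, DirectSum.sum_apply, DirectSum.decompose_zero, DirectSum.zero_apply,
    Submodule.coe_zero, AddSubmonoidClass.coe_finsetSum] at h' ⊢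
  rw [← h']
  refine Finset.sum_congr rfl fun i _ => ?_
  have e : lam + γ = (γ - δd i) + (lam + δd i) := by abel
  rw [e, DirectSum.coe_decompose_mul_add_of_right_mem 𝒜 (hd i lam b hb)]

theorem sum_mulL_mul_der {𝒜 : Γ → Submodule F A} {ε : Γ → Γ → F}
    (hε : IsBichar ε) {d : I → Module.End F A} {δd : I → Γ} {s : Finset I} {c : I → A} {γ : Γ}
    (hc : ∀ i, c i ∈ 𝒜 (γ - δd i)) (h : ∑ i ∈ s, mulL F A (c i) * d i = 0)
    {δ : Γ} {f : Module.End F A} (hf : IsColorDer 𝒜 ε δ f)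
    (hfd : ∀ i, f * d i = ε δ (δd i) • (d i * f)) :
    ∑ i ∈ s, mulL F A (f (c i)) * d i = 0 := by
  have key : f * ∑ i ∈ s, mulL F A (c i) * d i =
      ∑ i ∈ s, mulL F A (f (c i)) * d i + ε δ γ • ((∑ i ∈ s, mulL F A (c i) * d i) * f) := by
    rw [Finset.mul_sum, Finset.sum_mul, Finset.smul_sum, ← Finset.sum_add_distrib]
    refine Finset.sum_congr rfl fun i _ => ?_
    have e : ε δ γ = ε δ (γ - δd i) * ε δ (δd i) := by rw [← hε.2, sub_add_cancel]
    rw [← mul_assoc, hf.mul_mulL (hc i), add_mul, smul_mul_assoc, mul_assoc _ f, hfd, e,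
      mul_smul_comm, smul_smul, mul_assoc]
  simpa [h] using key.symm

theorem linearIndependent_over_algebra {𝒜 : Γ → Submodule F A} [GradedAlgebra 𝒜] {ε : Γ → Γ → F}
    (hε : IsBichar ε) {D : Submodule F (Module.End F A)} (hDgr : DGraded 𝒜 ε D)
    (hsimple : GradedDSimple 𝒜 D) {d : I → Module.End F A} {δd : I → Γ}
    (hd : ∀ i, IsHomogMap 𝒜 (δd i) (d i))
    (hDd : ∀ δ, ∀ f ∈ D, IsColorDer 𝒜 ε δ f → ∀ i, f * d i = ε δ (δd i) • (d i * f))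
    (hdind : ∀ (s : Finset I) (c : I → A), (∀ i, c i ∈ F1 D) →
      (∑ i ∈ s, mulL F A (c i) * d i) = 0 → ∀ i ∈ s, c i = 0)
    (s : Finset I) : ∀ c : I → A, ∑ i ∈ s, mulL F A (c i) * d i = 0 → ∀ i ∈ s, c i = 0 := by
  induction s using Finset.induction_on with
  | empty => simp
  | insert j s hj ih =>
    let J : Ideal A :=
      { carrier := {a | ∃ c : I → A, c j = a ∧ ∑ i ∈ insert j s, mulL F A (c i) * d i = 0}
        add_mem' := by
          rintro _ _ ⟨c, rfl, hc⟩ ⟨c', rfl, hc'⟩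
          exact ⟨c + c', rfl, by simp [add_mul, Finset.sum_add_distrib, -Finset.sum_insert, hc, hc']⟩
        zero_mem' := ⟨0, rfl, by simp⟩
        smul_mem' := by
          rintro a _ ⟨c, rfl, hc⟩
          refine ⟨fun i => a * c i, rfl, ?_⟩
          simp only [mulL_mul, mul_assoc, ← Finset.mul_sum, hc, mul_zero] }
    have hJcomp : ∀ c : I → A, ∑ i ∈ insert j s, mulL F A (c i) * d i = 0 → ∀ lam,
        ∃ (c' : I → A), c' j = (DirectSum.decompose 𝒜 (c j) lam : A) ∧
          (∀ i, c' i ∈ 𝒜 (lam + δd j - δd i)) ∧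
          ∑ i ∈ insert j s, mulL F A (c' i) * d i = 0 := by
      intro c hc lam
      exact ⟨_, by rw [add_sub_cancel_right], fun i => SetLike.coe_mem _,
        sum_mulL_mul_component hd hc (lam + δd j)⟩
    have hJhom : J.IsHomogeneous 𝒜 := by
      rintro lam _ ⟨c, rfl, hc⟩
      obtain ⟨c', h, -, h'⟩ := hJcomp c hc lam
      exact ⟨c', h, h'⟩
    have hJD : ∀ f ∈ D, ∀ x ∈ J, f x ∈ J := by
      intro f hf
      rw [hDgr] at hf
      induction hf using Submodule.span_induction with
      | mem f hf =>
        obtain ⟨hf, δ, hδ⟩ := hf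
        rintro _ ⟨c, rfl, hc⟩
        classical
        rw [← DirectSum.sum_support_decompose 𝒜 (c j), map_sum]
        refine Submodule.sum_mem _ fun lam _ => ?_
        obtain ⟨c', h, hhom, h'⟩ := hJcomp c hc lam
        exact ⟨fun i => f (c' i), congrArg f h, sum_mulL_mul_der hε hhom h' hδ (hDd δ f hf hδ)⟩
      | zero => exact fun x _ => J.zero_mem
      | add f g _ _ hf hg => exact fun x hx => J.add_mem (hf x hx) (hg x hx)
      | smul r f _ hf =>
        intro x hx
        rw [LinearMap.smul_apply, ← algebraMap_smul A]
        exact J.smul_mem _ (hf x hx)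
    intro c hc
    obtain hJ | hJ := hsimple J hJhom hJD
    · have hcj : c j = 0 := by
        have : c j ∈ J := ⟨c, rfl, hc⟩
        rwa [hJ, Ideal.mem_bot] at this
      rw [Finset.sum_insert hj, hcj, map_zero, zero_mul, zero_add] at hc
      intro i hi
      obtain rfl | hi := Finset.mem_insert.1 hi
      exacts [hcj, ih c hc i hi]
    · obtain ⟨c₁, hc₁, hc₁'⟩ : (1 : A) ∈ J := hJ ▸ Submodule.mem_top
      obtain ⟨c₂, hc₂, hhom, hc₂'⟩ := hJcomp c₁ hc₁' 0
      rw [hc₁, DirectSum.decompose_of_mem_same 𝒜 SetLike.GradedOne.one_mem] at hc₂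
      have hker : ∀ f ∈ D, ∀ i ∈ insert j s, f (c₂ i) = 0 := by
        intro f hf
        rw [hDgr] at hf
        induction hf using Submodule.span_induction with
        | mem f hf =>
          obtain ⟨hf, δ, hδ⟩ := hf
          have h := sum_mulL_mul_der hε hhom hc₂' hδ (hDd δ f hf hδ)
          have hfj : f (c₂ j) = 0 := by rw [hc₂, hδ.apply_one hε]
          rw [Finset.sum_insert hj, hfj, map_zero, zero_mul, zero_add] at h
          intro i hi
          obtain rfl | hi := Finset.mem_insert.1 hi
          exacts [hfj, ih _ h i hi]
        | zero => exact fun i _ => rfl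
        | add f g _ _ hf hg => exact fun i hi => by rw [LinearMap.add_apply, hf i hi, hg i hi, add_zero]
        | smul r f _ hf => exact fun i hi => by rw [LinearMap.smul_apply, hf i hi, smul_zero]
      have h1 : (1 : A) = 0 := by
        have := hdind (insert j s) (fun i => if i ∈ insert j s then c₂ i else 0)
          (fun i => by
            split_ifs with hi
            exacts [fun f hf => hker f hf i hi, Submodule.zero_mem _])
          (by
            rw [← hc₂']
            exact Finset.sum_congr rfl fun i hi => by rw [if_pos hi]) j (Finset.mem_insert_self j s)
        simpa [hc₂] using this
      intro i _
      rw [← one_mul (c i), h1, zero_mul]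

/-! ### Equality up to a nonzero scalar -/

/-- `x` and `y` agree up to a nonzero scalar. -/
def UnitSmulEq (x y : Module.End F A) : Prop := ∃ u : F, u ≠ 0 ∧ x = u • y

namespace UnitSmulEq

theorem refl (x : Module.End F A) : UnitSmulEq x x := ⟨1, one_ne_zero, (one_smul F x).symm⟩

theorem of_eq {x y : Module.End F A} (h : x = y) : UnitSmulEq x y := h ▸ refl x

theorem symm {x y : Module.End F A} : UnitSmulEq x y → UnitSmulEq y x
  | ⟨u, hu, h⟩ => ⟨u⁻¹, inv_ne_zero hu, by rw [h, inv_smul_smul₀ hu]⟩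

theorem trans {x y z : Module.End F A} : UnitSmulEq x y → UnitSmulEq y z → UnitSmulEq x z
  | ⟨u, hu, h⟩, ⟨v, hv, h'⟩ => ⟨u * v, mul_ne_zero hu hv, by rw [h, h', smul_smul]⟩

theorem mul {x y z w : Module.End F A} :
    UnitSmulEq x y → UnitSmulEq z w → UnitSmulEq (x * z) (y * w)
  | ⟨u, hu, h⟩, ⟨v, hv, h'⟩ => ⟨u * v, mul_ne_zero hu hv, by rw [h, h', smul_mul_smul_comm]⟩

theorem mul_left (x : Module.End F A) {y z : Module.End F A} (h : UnitSmulEq y z) :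
    UnitSmulEq (x * y) (x * z) := (refl x).mul h

theorem mul_right {y z : Module.End F A} (h : UnitSmulEq y z) (x : Module.End F A) :
    UnitSmulEq (y * x) (z * x) := h.mul (refl x)

theorem pow_mul_comm {x y : Module.End F A} (h : UnitSmulEq (x * y) (y * x)) (n : ℕ) :
    UnitSmulEq (x ^ n * y) (y * x ^ n) := by
  induction n with
  | zero => exact of_eq (by simp)
  | succ n ih =>
    rw [pow_succ, mul_assoc]
    refine (h.mul_left _).trans ?_
    rw [← mul_assoc, ← mul_assoc]
    exact ih.mul_right x

theorem pow_mul_pow_comm {x y : Module.End F A} (h : UnitSmulEq (x * y) (y * x)) (m n : ℕ) :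
    UnitSmulEq (x ^ m * y ^ n) (y ^ n * x ^ m) :=
  (pow_mul_comm (h.pow_mul_comm m).symm n).symm

theorem list_prod_perm {f : I → Module.End F A} (hf : ∀ i j, UnitSmulEq (f i * f j) (f j * f i))
    {l l' : List I} (h : l.Perm l') : UnitSmulEq (l.map f).prod (l'.map f).prod := by
  induction h with
  | nil => exact refl _
  | cons i _ ih => simpa using ih.mul_left (f i)
  | swap i j l => simpa [mul_assoc] using (hf j i).mul_right (l.map f).prod
  | trans _ _ ih ih' => exact ih.trans ih'

end UnitSmulEq

/-! ### Ordered monomials in a color-commuting family of color-derivations -/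

/-- A color-commuting family of homogeneous color-derivations. -/
structure IsColorFamily (𝒜 : Γ → Submodule F A) (ε : Γ → Γ → F) (δd : I → Γ)
    (d : I → Module.End F A) : Prop where
  bichar : IsBichar ε
  der : ∀ i, IsColorDer 𝒜 ε (δd i) (d i)
  comm : ∀ i j, d i * d j = ε (δd i) (δd j) • (d j * d i)

theorem dpow_zero (d : I → Module.End F A) : dpow d 0 = 1 := by simp [dpow]

theorem dpow_single (d : I → Module.End F A) (i : I) (n : ℕ) :
    dpow d (Finsupp.single i n) = d i ^ n := by
  obtain rfl | hn := eq_or_ne n 0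
  · simp [dpow_zero]
  · simp [dpow, Finsupp.support_single, hn]

theorem degJ_single_add (δd : I → Γ) (j : I) (n : ℕ) (α : I →₀ ℕ) :
    degJ δd (Finsupp.single j n + α) = n • δd j + degJ δd α := by
  rw [degJ, Finsupp.sum_add_index' (by simp) (by simp [add_smul]),
    Finsupp.sum_single_index (by simp), degJ]

namespace IsColorFamily

variable {𝒜 : Γ → Submodule F A} {ε : Γ → Γ → F} {δd : I → Γ} {d : I → Module.End F A}

theorem unitSmulEq_pow_mul_pow (h : IsColorFamily 𝒜 ε δd d) (i j : I) (m n : ℕ) :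
    UnitSmulEq (d i ^ m * d j ^ n) (d j ^ n * d i ^ m) :=
  UnitSmulEq.pow_mul_pow_comm ⟨_, h.bichar.ne_zero _ _, h.comm i j⟩ m n

theorem dpow_erase (h : IsColorFamily 𝒜 ε δd d) (α : I →₀ ℕ) (i : I) :
    UnitSmulEq (dpow d α) (d i ^ α i * dpow d (α.erase i)) := by
  by_cases hi : i ∈ α.support
  · have hperm : (α.support.sort (· ≤ ·)).Perm (i :: (α.erase i).support.sort (· ≤ ·)) := by
      refine (List.perm_ext_iff_of_nodup (Finset.sort_nodup _ _) ?_).2 fun j => ?_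
      · exact List.nodup_cons.2 ⟨by simp, Finset.sort_nodup _ _⟩
      · by_cases hj : j = i
        · subst hj; simpa using hi
        · simp [hj]
    refine (UnitSmulEq.list_prod_perm (fun i j => h.unitSmulEq_pow_mul_pow i j _ _) hperm).trans
      (UnitSmulEq.of_eq ?_)
    rw [List.map_cons, List.prod_cons, dpow]
    congr 2
    refine List.map_congr_left fun j hj => ?_
    have hj' : j ≠ i := by
      rintro rfl
      simp at hj
    rw [Finsupp.erase_ne hj']
  · rw [Finsupp.erase_of_notMem_support hi, Finsupp.notMem_support_iff.1 hi, pow_zero, one_mul]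
    exact UnitSmulEq.refl _

theorem pow_mul_dpow (h : IsColorFamily 𝒜 ε δd d) (j : I) (n : ℕ) (β : I →₀ ℕ) :
    UnitSmulEq (d j ^ n * dpow d β) (dpow d (Finsupp.single j n + β)) := by
  refine ((h.dpow_erase β j).mul_left _).trans (UnitSmulEq.symm ?_)
  refine (h.dpow_erase _ j).trans (UnitSmulEq.of_eq ?_)
  rw [Finsupp.erase_add, Finsupp.erase_single, zero_add, ← mul_assoc, ← pow_add]
  simp

theorem dpow_mul_dpow (h : IsColorFamily 𝒜 ε δd d) (α β : I →₀ ℕ) :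
    UnitSmulEq (dpow d α * dpow d β) (dpow d (α + β)) := by
  induction α using Finsupp.induction with
  | zero => simpa [dpow_zero] using UnitSmulEq.refl _
  | single_add j n α _ _ ih =>
    refine ((h.pow_mul_dpow j n α).symm.mul_right _).trans ?_
    rw [mul_assoc, add_assoc]
    exact (ih.mul_left _).trans (h.pow_mul_dpow j n _)

theorem isHomogMap_dpow (h : IsColorFamily 𝒜 ε δd d) (α : I →₀ ℕ) :
    IsHomogMap 𝒜 (degJ δd α) (dpow d α) := by
  induction α using Finsupp.induction with
  | zero => simpa [dpow_zero, degJ] using isHomogMap_one 𝒜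
  | single_add j n α _ _ ih =>
    obtain ⟨u, -, hu⟩ := (h.pow_mul_dpow j n α).symm
    rw [hu, degJ_single_add]
    exact fun lam a ha => Submodule.smul_mem _ _ (((h.der j).1.pow n).mul ih lam a ha)

theorem sq_eq_zero (h : IsColorFamily 𝒜 ε δd d) (hchar : (2 : F) ≠ 0) {i : I}
    (hi : ε (δd i) (δd i) = -1) : d i ^ 2 = 0 := by
  ext a
  have hneg := LinearMap.congr_fun (h.comm i i) a
  rw [hi, LinearMap.smul_apply, neg_smul, one_smul, eq_neg_iff_add_eq_zero, ← two_smul F] at hneg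
  rw [sq]
  exact (smul_eq_zero.1 hneg).resolve_left hchar

theorem exists_mul_mulL [GradedAlgebra 𝒜] (h : IsColorFamily 𝒜 ε δd d) (i : I) (c : A) :
    ∃ c' : A, d i * mulL F A c = mulL F A (d i c) + mulL F A c' * d i := by
  induction c using DirectSum.Decomposition.inductionOn 𝒜 with
  | zero => exact ⟨0, by simp⟩
  | @homogeneous mu c =>
    exact ⟨ε (δd i) mu • (c : A), by rw [(h.der i).mul_mulL c.2, map_smul, smul_mul_assoc]⟩
  | add a b ha hb =>
    obtain ⟨a', ha⟩ := ha
    obtain ⟨b', hb⟩ := hb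
    exact ⟨a' + b', by rw [map_add, mul_add, ha, hb, map_add, map_add, map_add, add_mul]; abel⟩

end IsColorFamily

/-- The `A`-span of the monomials `d^β` with `β ∈ S`. -/
def monoSpan (d : I → Module.End F A) (S : Set (I →₀ ℕ)) : Submodule F (Module.End F A) :=
  Submodule.span F {x | ∃ c : A, ∃ β ∈ S, x = mulL F A c * dpow d β}

section monoSpan

variable {d : I → Module.End F A} {S T : Set (I →₀ ℕ)}

theorem mulL_mul_dpow_mem (c : A) {β : I →₀ ℕ} (hβ : β ∈ S) :
    mulL F A c * dpow d β ∈ monoSpan d S :=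
  Submodule.subset_span ⟨c, β, hβ, rfl⟩

theorem dpow_mem_monoSpan {β : I →₀ ℕ} (hβ : β ∈ S) : dpow d β ∈ monoSpan d S := by
  simpa [mulL_one] using mulL_mul_dpow_mem (d := d) (1 : A) hβ

theorem monoSpan_mono (h : S ⊆ T) : monoSpan d S ≤ monoSpan d T :=
  Submodule.span_mono fun _ ⟨c, β, hβ, hx⟩ => ⟨c, β, h hβ, hx⟩

theorem mulL_mul_mem (a : A) {x : Module.End F A} (hx : x ∈ monoSpan d S) :
    mulL F A a * x ∈ monoSpan d S := by
  induction hx using Submodule.span_induction with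
  | mem x hx =>
    obtain ⟨c, β, hβ, rfl⟩ := hx
    rw [← mul_assoc, ← mulL_mul]
    exact mulL_mul_dpow_mem _ hβ
  | zero => simp
  | add x y _ _ hx hy => rw [mul_add]; exact add_mem hx hy
  | smul r x _ hx => rw [mul_smul_comm]; exact Submodule.smul_mem _ _ hx

theorem monoSpan_le (h : ∀ β ∈ S, dpow d β ∈ monoSpan d T) : monoSpan d S ≤ monoSpan d T := by
  refine Submodule.span_le.2 ?_
  rintro _ ⟨c, β, hβ, rfl⟩
  exact mulL_mul_mem c (h β hβ)

theorem UnitSmulEq.mem_iff {x y : Module.End F A} (h : UnitSmulEq x y)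
    {p : Submodule F (Module.End F A)} : x ∈ p ↔ y ∈ p := by
  obtain ⟨u, hu, rfl⟩ := h
  exact p.smul_mem_iff hu

variable {𝒜 : Γ → Submodule F A} {ε : Γ → Γ → F} {δd : I → Γ}

theorem IsColorFamily.d_mul_mem [GradedAlgebra 𝒜] (h : IsColorFamily 𝒜 ε δd d) (j : I)
    (hS : ∀ β ∈ S, β ∈ T ∧ Finsupp.single j 1 + β ∈ T) {x : Module.End F A}
    (hx : x ∈ monoSpan d S) : d j * x ∈ monoSpan d T := by
  induction hx using Submodule.span_induction with
  | mem x hx =>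
    obtain ⟨c, β, hβ, rfl⟩ := hx
    obtain ⟨c', hc'⟩ := h.exists_mul_mulL j c
    rw [← mul_assoc, hc', add_mul, mul_assoc]
    refine add_mem (mulL_mul_dpow_mem _ (hS β hβ).1) (mulL_mul_mem _ ?_)
    have := h.pow_mul_dpow j 1 β
    rw [pow_one] at this
    exact this.mem_iff.2 (dpow_mem_monoSpan (hS β hβ).2)
  | zero => simp
  | add x y _ _ hx hy => rw [mul_add]; exact add_mem hx hy
  | smul r x _ hx => rw [mul_smul_comm]; exact Submodule.smul_mem _ _ hx

theorem IsColorFamily.mul_dpow_mem (h : IsColorFamily 𝒜 ε δd d) (γ : I →₀ ℕ)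
    (hS : ∀ β ∈ S, β + γ ∈ T) {x : Module.End F A}
    (hx : x ∈ monoSpan d S) : x * dpow d γ ∈ monoSpan d T := by
  induction hx using Submodule.span_induction with
  | mem x hx =>
    obtain ⟨c, β, hβ, rfl⟩ := hx
    rw [mul_assoc]
    exact mulL_mul_mem _ ((h.dpow_mul_dpow β γ).mem_iff.2 (dpow_mem_monoSpan (hS β hβ)))
  | zero => simp
  | add x y _ _ hx hy => rw [add_mul]; exact add_mem hx hy
  | smul r x _ hx => rw [smul_mul_assoc]; exact Submodule.smul_mem _ _ hx

theorem IsColorFamily.pow_mul_mem [GradedAlgebra 𝒜] (h : IsColorFamily 𝒜 ε δd d) (j : I) (n : ℕ)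
    {k m : ℕ} {x : Module.End F A} (hx : x ∈ monoSpan d {β | β.degree + k ≤ m}) :
    d j ^ n * x ∈ monoSpan d {β | β.degree + k ≤ n + m} := by
  induction n with
  | zero => simpa using hx
  | succ n ih =>
    rw [pow_succ', mul_assoc]
    refine h.d_mul_mem j (fun β hβ => ?_) ih
    simp only [Set.mem_ofPred_eq, map_add, Finsupp.degree_single] at hβ ⊢
    omega

/-- Every monomial reduces to monomials with exponents in `𝒥` of no larger total degree. -/
theorem IsColorFamily.dpow_mem_inJ [GradedAlgebra 𝒜] (h : IsColorFamily 𝒜 ε δd d)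
    (hchar : (2 : F) ≠ 0)
    (hp : ∀ i, ε (δd i) (δd i) = 1 → ringChar F ≠ 0 → ∃ (s : Finset I) (c : I → A),
      d i ^ ringChar F = ∑ j ∈ s, mulL F A (c j) * d j)
    (α : I →₀ ℕ) : dpow d α ∈ monoSpan d {β | inJ ε δd β ∧ β.degree ≤ α.degree} := by
  induction hm : α.degree using Nat.strong_induction_on generalizing α with
  | _ m ih =>
  by_cases hα : inJ ε δd α
  · exact dpow_mem_monoSpan ⟨hα, hm.le⟩
  have hodd : ∀ i, ε (δd i) (δd i) = -1 → 2 ≤ α i →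
      dpow d α ∈ monoSpan d {β | inJ ε δd β ∧ β.degree ≤ m} := by
    intro i hi h2
    refine (h.dpow_erase α i).mem_iff.2 ?_
    rw [← Nat.sub_add_cancel h2, pow_add, h.sq_eq_zero hchar hi, mul_zero, zero_mul]
    exact zero_mem _
  rw [inJ, not_and_or] at hα
  push Not at hα
  obtain ⟨i, hchar0, hi⟩ | ⟨i, hi, h2⟩ := hα
  · have hprime : (ringChar F).Prime :=
      (CharP.char_is_prime_or_zero F (ringChar F)).resolve_right hchar0
    have hle : ringChar F ≤ α i := by omega
    obtain heven | hi' := h.bichar.self_eq_one_or (δd i)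
    · obtain ⟨s, c, hsc⟩ := hp i heven hchar0
      refine (h.dpow_erase α i).mem_iff.2 ?_
      obtain ⟨q, hq⟩ := Nat.exists_eq_add_of_le hle
      rw [hq, pow_add, mul_assoc, hsc, Finset.sum_mul]
      refine Submodule.sum_mem _ fun j _ => ?_
      rw [mul_assoc]
      refine mulL_mul_mem _ ?_
      have h1 := (h.pow_mul_dpow i q (α.erase i)).mul_left (d j ^ 1)
      have h2 := h1.trans (h.pow_mul_dpow j 1 _)
      rw [pow_one] at h2
      have hdeg : α.degree = α i + (α.erase i).degree := by
        conv_lhs => rw [← Finsupp.single_add_erase i α]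
        rw [map_add, Finsupp.degree_single]
      have hlt : (Finsupp.single j 1 + (Finsupp.single i q + α.erase i)).degree < m := by
        rw [map_add, map_add, Finsupp.degree_single, Finsupp.degree_single]
        have := hprime.two_le
        omega
      have hsub : {β | inJ ε δd β ∧
          β.degree ≤ (Finsupp.single j 1 + (Finsupp.single i q + α.erase i)).degree} ⊆
          {β | inJ ε δd β ∧ β.degree ≤ m} := fun β hβ => ⟨hβ.1, hβ.2.trans hlt.le⟩
      exact h2.mem_iff.2 (monoSpan_mono hsub (ih _ hlt _ rfl))
    · exact hodd i hi' (hprime.two_le.trans hle)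
  · exact hodd i hi h2

end monoSpan

/-! ### Moving monomials past multiplication operators -/

section expansion

variable {𝒜 : Γ → Submodule F A} {ε : Γ → Γ → F} {δd : I → Γ} {d : I → Module.End F A}

theorem IsColorFamily.pow_mul_mulL [GradedAlgebra 𝒜] (h : IsColorFamily 𝒜 ε δd d) (j : I) (n : ℕ)
    (hn : ε (δd j) (δd j) = -1 → n ≤ 1) {mu : Γ} {b : A} (hb : b ∈ 𝒜 mu) :
    ∃ r ∈ monoSpan d {β | β.degree + 2 ≤ n},
      d j ^ n * mulL F A b = ε (n • δd j) mu • (mulL F A b * d j ^ n +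
        ((n : F) * ε mu (δd j)) • (mulL F A (d j b) * d j ^ (n - 1))) + r := by
  induction n with
  | zero => exact ⟨0, zero_mem _, by simp [h.bichar.zero_left]⟩
  | succ n ih =>
    have hinv := h.bichar.1 (δd j) mu
    obtain _ | n := n
    · refine ⟨0, zero_mem _, ?_⟩
      rw [zero_add, one_smul, pow_one, (h.der j).mul_mulL hb, smul_add, smul_smul, Nat.cast_one,
        one_mul, hinv]
      simp [add_comm]
    · have heven : ε (δd j) (δd j) = 1 :=
        (h.bichar.self_eq_one_or (δd j)).resolve_right fun hodd => by
          have := hn hodd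
          omega
      obtain ⟨r, hr, hrec⟩ := ih fun hodd => by
        have := hn hodd
        omega
      have hdr := h.pow_mul_mem j 1 hr
      rw [pow_one] at hdr
      have hlow : mulL F A (d j (d j b)) * d j ^ n ∈ monoSpan d {β | β.degree + 2 ≤ n + 1 + 1} := by
        rw [← dpow_single]
        exact mulL_mul_dpow_mem _ (by simp)
      refine ⟨(ε ((n + 1) • δd j) mu * (((n + 1 : ℕ) : F) * ε mu (δd j))) •
        (mulL F A (d j (d j b)) * d j ^ n) + d j * r, ?_, ?_⟩
      · refine add_mem (Submodule.smul_mem _ _ hlow) ?_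
        rwa [add_comm 1 (n + 1)] at hdr
      · have h1 : d j * (mulL F A b * d j ^ (n + 1)) = mulL F A (d j b) * d j ^ (n + 1) +
            ε (δd j) mu • (mulL F A b * d j ^ (n + 1 + 1)) := by
          rw [← mul_assoc, (h.der j).mul_mulL hb, add_mul, smul_mul_assoc, mul_assoc _ (d j),
            ← pow_succ']
        have h2 : d j * (mulL F A (d j b) * d j ^ n) = mulL F A (d j (d j b)) * d j ^ n +
            ε (δd j) mu • (mulL F A (d j b) * d j ^ (n + 1)) := by
          rw [← mul_assoc, (h.der j).mul_mulL ((h.der j).1 mu b hb), add_mul, smul_mul_assoc,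
            mul_assoc _ (d j), ← pow_succ', h.bichar.2, heven, mul_one]
        rw [pow_succ' (d j) (n + 1), mul_assoc, hrec, mul_add, mul_smul_comm, mul_add,
          mul_smul_comm, Nat.add_sub_cancel, Nat.add_sub_cancel, h1, h2, succ_nsmul _ (n + 1),
          h.bichar.add_left, ← pow_succ']
        match_scalars
        · linear_combination -ε ((n + 1) • δd j) mu * hinv
        · ring
        · ring
        · ring

theorem IsColorFamily.pow_mul_mulL_leading [GradedAlgebra 𝒜] (h : IsColorFamily 𝒜 ε δd d) (j : I)
    (n : ℕ) (hn : ε (δd j) (δd j) = -1 → n ≤ 1) {mu : Γ} {b : A} (hb : b ∈ 𝒜 mu) :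
    ∃ r ∈ monoSpan d {β | β.degree + 1 ≤ n},
      d j ^ n * mulL F A b = ε (n • δd j) mu • (mulL F A b * d j ^ n) + r := by
  obtain _ | n := n
  · exact ⟨0, zero_mem _, by simp [h.bichar.zero_left]⟩
  obtain ⟨r, hr, e⟩ := h.pow_mul_mulL j (n + 1) hn hb
  refine ⟨_, add_mem (Submodule.smul_mem _ (ε ((n + 1) • δd j) mu) (Submodule.smul_mem _
    (((n + 1 : ℕ) : F) * ε mu (δd j)) (?_ : mulL F A (d j b) * d j ^ n ∈ _)))
    (monoSpan_mono (fun β (hβ : β.degree + 2 ≤ n + 1) => ?_) hr), ?_⟩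
  · rw [← dpow_single]
    exact mulL_mul_dpow_mem _ (by simp)
  · rw [Set.mem_ofPred_eq]
    omega
  · rw [e, smul_add, add_assoc, Nat.add_sub_cancel]

theorem single_add_tsub_single_of_ne {i j : I} (hij : i ≠ j) (n : ℕ) (α : I →₀ ℕ) :
    Finsupp.single j n + α - Finsupp.single i 1 = Finsupp.single j n + (α - Finsupp.single i 1) := by
  ext l
  by_cases hl : l = i
  · subst hl
    simp [hij]
  · simp [Ne.symm hl]

theorem single_add_tsub_single_self (j : I) {n : ℕ} (hn : n ≠ 0) (α : I →₀ ℕ) :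
    Finsupp.single j n + α - Finsupp.single j 1 = Finsupp.single j (n - 1) + α := by
  ext l
  by_cases hl : l = j
  · subst hl
    simp
    omega
  · simp [Ne.symm hl]

/-- The expansion of `d^α b` modulo monomials whose total degree drops by at least two. -/
theorem IsColorFamily.exists_dpow_mul_mulL [GradedAlgebra 𝒜] (h : IsColorFamily 𝒜 ε δd d)
    (α : I →₀ ℕ) (hodd : ∀ i, ε (δd i) (δd i) = -1 → α i ≤ 1)
    (hcast : ∀ i ∈ α.support, (α i : F) ≠ 0) :
    ∃ k : I → F, (∀ i ∈ α.support, k i ≠ 0) ∧ ∀ mu, ∀ b ∈ 𝒜 mu,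
      ∃ r ∈ monoSpan d {β | β.degree + 2 ≤ α.degree},
        dpow d α * mulL F A b = ε (degJ δd α) mu • (mulL F A b * dpow d α +
          ∑ i ∈ α.support, (k i * ε mu (δd i)) •
            (mulL F A (d i b) * dpow d (α - Finsupp.single i 1))) + r := by
  induction α using Finsupp.induction with
  | zero =>
    exact ⟨0, by simp, fun mu b _ => ⟨0, zero_mem _, by simp [dpow_zero, degJ, h.bichar.zero_left]⟩⟩
  | single_add j n α hj hn ih =>
    have hαj : α j = 0 := Finsupp.notMem_support_iff.1 hj
    have hsupp : (Finsupp.single j n + α).support = insert j α.support := by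
      rw [Finsupp.support_single_add hj hn, Finset.cons_eq_insert]
    have hne : ∀ i ∈ α.support, i ≠ j := fun i hi hij => hj (hij ▸ hi)
    have happ : ∀ i ∈ α.support, (Finsupp.single j n + α) i = α i := fun i hi => by
      simp [(hne i hi).symm]
    obtain ⟨k, hk, hexp⟩ := ih
      (fun i hi => (Nat.le_add_left _ _).trans (hodd i hi))
      (fun i hi => by simpa [happ i hi] using hcast i (by simp [hsupp, Finset.mem_insert_of_mem hi]))
    have hnodd : ε (δd j) (δd j) = -1 → n ≤ 1 := fun hi => by simpa [hαj] using hodd j hi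
    have hncast : (n : F) ≠ 0 := by simpa [hαj] using hcast j (by simp [hsupp])
    obtain ⟨u, hu, hP⟩ := (h.pow_mul_dpow j n α).symm
    obtain ⟨w, hw, hPj⟩ := h.pow_mul_dpow j (n - 1) α
    choose v hv hPi using fun i => h.pow_mul_dpow j n (α - Finsupp.single i 1)
    refine ⟨fun i => if i = j then u * n * w else u * k i * ε (n • δd j) (δd i) * v i, ?_, ?_⟩
    · intro i hi
      rw [hsupp, Finset.mem_insert] at hi
      obtain rfl | hi := hi
      · simp [hu, hw, hncast]
      · simp only [hne i hi, if_false]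
        exact mul_ne_zero (mul_ne_zero (mul_ne_zero hu (hk i hi)) (h.bichar.ne_zero _ _)) (hv i)
    intro mu b hb
    obtain ⟨r, hr, hrb⟩ := hexp mu b hb
    obtain ⟨t, ht, htb⟩ := h.pow_mul_mulL j n hnodd hb
    choose s hs hsb using fun i => h.pow_mul_mulL_leading j n hnodd ((h.der i).1 mu b hb)
    have hdeg : (Finsupp.single j n + α).degree = n + α.degree := by simp
    have hterm : ∀ i ∈ α.support, d j ^ n * (mulL F A (d i b) * dpow d (α - Finsupp.single i 1)) =
        (ε (n • δd j) mu * ε (n • δd j) (δd i) * v i) • (mulL F A (d i b) *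
          dpow d (Finsupp.single j n + α - Finsupp.single i 1)) +
        s i * dpow d (α - Finsupp.single i 1) := fun i hi => by
      rw [← mul_assoc, hsb, add_mul, smul_mul_assoc, mul_assoc _ (d j ^ n), hPi, mul_smul_comm,
        smul_smul, h.bichar.2, single_add_tsub_single_of_ne (hne i hi)]
    refine ⟨(u * ε (degJ δd α) mu) • (t * dpow d α) + (u * ε (degJ δd α) mu) • ∑ i ∈ α.support,
      (k i * ε mu (δd i)) • (s i * dpow d (α - Finsupp.single i 1)) + u • (d j ^ n * r), ?_, ?_⟩
    · rw [hdeg]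
      refine add_mem (add_mem (Submodule.smul_mem _ _ ?_) (Submodule.smul_mem _ _
        (Submodule.sum_mem _ fun i hi => Submodule.smul_mem _ _ ?_)))
        (Submodule.smul_mem _ _ (h.pow_mul_mem j n hr))
      · refine h.mul_dpow_mem α (fun β hβ => ?_) ht
        simp only [Set.mem_ofPred_eq, map_add] at hβ ⊢
        omega
      · refine h.mul_dpow_mem _ (fun β hβ => ?_) (hs i)
        have hi1 : Finsupp.single i 1 ≤ α := by
          rw [Finsupp.single_le_iff]
          exact Nat.one_le_iff_ne_zero.2 (Finsupp.mem_support_iff.1 hi)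
        have hdi : (α - Finsupp.single i 1).degree + 1 = α.degree := by
          conv_rhs => rw [← tsub_add_cancel_of_le hi1]
          simp
        simp only [Set.mem_ofPred_eq, map_add] at hβ ⊢
        omega
    · have hsum : ∑ i ∈ α.support, (k i * ε mu (δd i)) •
          (d j ^ n * (mulL F A (d i b) * dpow d (α - Finsupp.single i 1))) =
          ε (n • δd j) mu • ∑ i ∈ α.support, ((k i * ε (n • δd j) (δd i) * v i) * ε mu (δd i)) •
            (mulL F A (d i b) * dpow d (Finsupp.single j n + α - Finsupp.single i 1)) +
          ∑ i ∈ α.support, (k i * ε mu (δd i)) • (s i * dpow d (α - Finsupp.single i 1)) := by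
        rw [Finset.smul_sum, ← Finset.sum_add_distrib]
        refine Finset.sum_congr rfl fun i hi => ?_
        rw [hterm i hi]
        module
      have hsum' : ∑ i ∈ α.support,
          ((if i = j then u * n * w else u * k i * ε (n • δd j) (δd i) * v i) * ε mu (δd i)) •
            (mulL F A (d i b) * dpow d (Finsupp.single j n + α - Finsupp.single i 1)) =
          u • ∑ i ∈ α.support, ((k i * ε (n • δd j) (δd i) * v i) * ε mu (δd i)) •
            (mulL F A (d i b) * dpow d (Finsupp.single j n + α - Finsupp.single i 1)) := by
        rw [Finset.smul_sum]
        refine Finset.sum_congr rfl fun i hi => ?_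
        rw [if_neg (hne i hi)]
        module
      rw [hsupp, Finset.sum_insert hj, hsum']
      beta_reduce
      rw [if_pos rfl, single_add_tsub_single_self j hn, hP,
        smul_mul_assoc, mul_assoc, hrb, mul_add, mul_smul_comm, mul_add, Finset.mul_sum]
      simp only [mul_smul_comm]
      rw [hsum, ← mul_assoc, htb, add_mul, smul_mul_assoc, add_mul, smul_mul_assoc, mul_assoc,
        mul_assoc, hPj, degJ_single_add, h.bichar.add_left, mul_smul_comm]
      module

end expansion

/-! ### Linear independence of the monomials -/

/-- The map sending a finitely supported family of coefficients to the operator it represents. -/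
noncomputable def monoMap (d : I → Module.End F A) : ((I →₀ ℕ) →₀ A) →ₗ[F] Module.End F A :=
  Finsupp.lsum F fun β => LinearMap.mulRight F (dpow d β) ∘ₗ mulL F A

theorem monoMap_apply (d : I → Module.End F A) (f : (I →₀ ℕ) →₀ A) :
    monoMap d f = ∑ β ∈ f.support, mulL F A (f β) * dpow d β := rfl

theorem monoMap_single (d : I → Module.End F A) (β : I →₀ ℕ) (a : A) :
    monoMap d (Finsupp.single β a) = mulL F A a * dpow d β := by
  simp [monoMap]

theorem exists_monoMap_eq {d : I → Module.End F A} {S : Set (I →₀ ℕ)} {x : Module.End F A}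
    (hx : x ∈ monoSpan d S) : ∃ f ∈ Finsupp.supported A F S, monoMap d f = x := by
  suffices h : monoSpan d S ≤ (Finsupp.supported A F S).map (monoMap d) from h hx
  refine Submodule.span_le.2 ?_
  rintro _ ⟨c, β, hβ, rfl⟩
  exact ⟨Finsupp.single β c, Finsupp.single_mem_supported F c hβ, monoMap_single d β c⟩

section inJ

variable {ε : Γ → Γ → F} {δd : I → Γ} {α β : I →₀ ℕ}

theorem inJ.of_le (hα : inJ ε δd α) (h : β ≤ α) : inJ ε δd β :=
  ⟨fun i hi => (h i).trans (hα.1 i hi), fun i hi => (h i).trans (hα.2 i hi)⟩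

theorem inJ.cast_ne_zero (hα : inJ ε δd α) {i : I} (hi : i ∈ α.support) : (α i : F) ≠ 0 := by
  intro h0
  have hdvd := (ringChar.spec F (α i)).1 h0
  have hpos : 0 < α i := Nat.pos_of_ne_zero (Finsupp.mem_support_iff.1 hi)
  have hle := Nat.le_of_dvd hpos hdvd
  have hne : ringChar F ≠ 0 := fun h => by
    rw [h, zero_dvd_iff] at hdvd
    omega
  have := hα.1 i hne
  omega

end inJ

theorem mem_support_and_tsub_single_eq_iff {α γ : I →₀ ℕ} {i : I} :
    i ∈ α.support ∧ α - Finsupp.single i 1 = γ ↔ α = Finsupp.single i 1 + γ := by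
  constructor
  · rintro ⟨hi, rfl⟩
    refine (add_tsub_cancel_of_le ?_).symm
    rw [Finsupp.single_le_iff]
    exact Nat.one_le_iff_ne_zero.2 (Finsupp.mem_support_iff.1 hi)
  · rintro rfl
    simp

/-- Extracting one coefficient from a double sum over exponents and their lowerings. -/
theorem sum_single_tsub_apply (S : Finset (I →₀ ℕ)) (x : (I →₀ ℕ) → I → A)
    (hx : ∀ α ∉ S, ∀ i, x α i = 0) (γ : I →₀ ℕ) :
    (∑ α ∈ S, ∑ i ∈ α.support, Finsupp.single (α - Finsupp.single i 1) (x α i)) γ =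
      ∑ i ∈ S.biUnion Finsupp.support, x (Finsupp.single i 1 + γ) i := by
  classical
  have hrow : ∀ α ∈ S,
      (∑ i ∈ α.support, Finsupp.single (α - Finsupp.single i 1) (x α i)) γ =
        ∑ i ∈ S.biUnion Finsupp.support, if α = Finsupp.single i 1 + γ then x α i else 0 := by
    intro α hα
    rw [Finsupp.finsetSum_apply]
    simp only [← mem_support_and_tsub_single_eq_iff, ite_and]
    rw [← Finset.sum_subset (Finset.subset_biUnion_of_mem Finsupp.support hα)
      fun i _ hi => if_neg hi]
    refine Finset.sum_congr rfl fun i hi => ?_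
    rw [if_pos hi, Finsupp.single_apply]
  rw [Finsupp.finsetSum_apply, Finset.sum_congr rfl hrow, Finset.sum_comm]
  refine Finset.sum_congr rfl fun i _ => ?_
  rw [Finset.sum_ite_eq' S (Finsupp.single i 1 + γ) fun α => x α i]
  split_ifs with h
  · rfl
  · exact (hx _ h i).symm

section independence

variable {𝒜 : Γ → Submodule F A} {ε : Γ → Γ → F} {δd : I → Γ} {d : I → Module.End F A}

theorem IsColorFamily.sum_smul_mulL_mul_eq_zero [GradedAlgebra 𝒜] (h : IsColorFamily 𝒜 ε δd d)
    (hcomm : IsColorComm 𝒜 ε) {s : Finset (I →₀ ℕ)} {c : (I →₀ ℕ) → A}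
    (hc : ∑ α ∈ s, mulL F A (c α) * dpow d α = 0) {mu : Γ} {b : A} (hb : b ∈ 𝒜 mu) :
    ∑ α ∈ s, mulL F A (c α) * (ε (degJ δd α) mu • (mulL F A b * dpow d α)) = 0 := by
  refine end_ext_homogeneous 𝒜 fun lam a ha => ?_
  have h0 : ∑ α ∈ s, c α * dpow d α a = 0 := by
    simpa [mulL_apply] using LinearMap.congr_fun hc a
  have key : ∑ α ∈ s, c α * (ε (degJ δd α) mu • (b * dpow d α a)) =
      ε mu lam • ((∑ α ∈ s, c α * dpow d α a) * b) := by
    rw [Finset.sum_mul, Finset.smul_sum]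
    refine Finset.sum_congr rfl fun α _ => ?_
    rw [hcomm mu _ b hb _ (h.isHomogMap_dpow α lam a ha), smul_smul, h.bichar.2, mul_left_comm,
      h.bichar.1, mul_one, mul_smul_comm, mul_assoc]
  simpa [mulL_apply, h0] using key

theorem IsColorFamily.monoMap_injective [GradedAlgebra 𝒜] (h : IsColorFamily 𝒜 ε δd d)
    (hcomm : IsColorComm 𝒜 ε)
    (hred : ∀ α, dpow d α ∈ monoSpan d {β | inJ ε δd β ∧ β.degree ≤ α.degree})
    (hind : ∀ (s : Finset I) (c : I → A), ∑ i ∈ s, mulL F A (c i) * d i = 0 → ∀ i ∈ s, c i = 0)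
    (m : ℕ) : ∀ f ∈ Finsupp.supported A F {β | inJ ε δd β ∧ β.degree < m},
      monoMap d f = 0 → f = 0 := by
  induction m with
  | zero =>
    intro f hf _
    simpa using hf
  | succ m ih =>
    intro f hf hf0
    have hfJ : ∀ α ∈ f.support, inJ ε δd α ∧ α.degree < m + 1 := fun α hα => hf hα
    suffices htop : ∀ α, α.degree = m → f α = 0 by
      refine ih f (fun α hα => ⟨(hfJ α hα).1, ?_⟩) hf0
      refine lt_of_le_of_ne (Nat.lt_succ_iff.1 (hfJ α hα).2) fun hα' => ?_
      exact Finsupp.mem_support_iff.1 hα (htop α hα')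
    intro α₀ hα₀
    by_contra hne
    have hα₀s : α₀ ∈ f.support := Finsupp.mem_support_iff.2 hne
    obtain rfl | hα₀0 := eq_or_ne α₀ 0
    · have hm : m = 0 := by simpa using hα₀.symm
      have hfs : f = Finsupp.single 0 (f 0) := by
        refine Finsupp.support_subset_singleton.1 fun α hα => ?_
        have := (hfJ α hα).2
        rw [Finset.mem_singleton, ← Finsupp.degree_eq_zero_iff]
        omega
      rw [hfs, monoMap_single, dpow_zero, mul_one] at hf0
      exact hne (mulL_injective hf0)
    obtain ⟨i₀, hi₀⟩ := Finsupp.support_nonempty_iff.2 hα₀0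
    obtain ⟨γ, hγ⟩ : ∃ γ, α₀ = Finsupp.single i₀ 1 + γ :=
      ⟨_, mem_support_and_tsub_single_eq_iff.1 ⟨hi₀, rfl⟩⟩
    choose! k hk hexp using fun α (hα : inJ ε δd α) =>
      h.exists_dpow_mul_mulL α hα.2 fun i hi => hα.cast_ne_zero hi
    have hop : ∑ i ∈ f.support.biUnion Finsupp.support,
        mulL F A (k (Finsupp.single i 1 + γ) i • f (Finsupp.single i 1 + γ)) * d i = 0 := by
      refine end_ext_homogeneous 𝒜 fun mu b hb => ?_
      choose! r hr hrb using fun α hα => hexp α hα mu b hb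
      set x : (I →₀ ℕ) → I → A := fun α i =>
        (ε (degJ δd α) mu * (k α i * ε mu (δd i))) • (f α * d i b) with hx
      set e : (I →₀ ℕ) →₀ A :=
        ∑ α ∈ f.support, ∑ i ∈ α.support, Finsupp.single (α - Finsupp.single i 1) (x α i) with he
      have hrel : monoMap d e + ∑ α ∈ f.support, mulL F A (f α) * r α = 0 := by
        have h1 : (∑ α ∈ f.support, mulL F A (f α) * dpow d α) * mulL F A b = 0 := by
          rw [← monoMap_apply, hf0, zero_mul]
        have h2 := h.sum_smul_mulL_mul_eq_zero hcomm ((monoMap_apply d f).symm.trans hf0) hb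
        have h3 : ∀ α ∈ f.support, mulL F A (f α) * dpow d α * mulL F A b =
            mulL F A (f α) * (ε (degJ δd α) mu • (mulL F A b * dpow d α)) +
            (∑ i ∈ α.support, mulL F A (x α i) * dpow d (α - Finsupp.single i 1) +
              mulL F A (f α) * r α) := fun α hα => by
          rw [mul_assoc, hrb α (hfJ α hα).1, smul_add, mul_add, mul_add, add_assoc]
          congr 2
          rw [Finset.smul_sum, Finset.mul_sum]
          refine Finset.sum_congr rfl fun i _ => ?_
          rw [smul_smul, mul_smul_comm, hx, map_smul, mulL_mul, smul_mul_assoc, mul_assoc]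
        rw [Finset.sum_mul, Finset.sum_congr rfl h3, Finset.sum_add_distrib, h2, zero_add,
          Finset.sum_add_distrib] at h1
        rw [← h1, he, map_sum]
        simp only [map_sum, monoMap_single]
      have hlow : ∑ α ∈ f.support, mulL F A (f α) * r α ∈
          monoSpan d {β | inJ ε δd β ∧ β.degree + 2 ≤ m} := by
        refine Submodule.sum_mem _ fun α hα => mulL_mul_mem _ ?_
        refine monoSpan_le (fun β hβ => ?_) (hr α (hfJ α hα).1)
        have hsub : {β' | inJ ε δd β' ∧ β'.degree ≤ β.degree} ⊆
            {β' | inJ ε δd β' ∧ β'.degree + 2 ≤ m} := fun β' hβ' => by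
          have h1 : β.degree + 2 ≤ α.degree := hβ
          have h2 := (hfJ α hα).2
          exact ⟨hβ'.1, by have := hβ'.2; omega⟩
        exact monoSpan_mono hsub (hred β)
      obtain ⟨g, hg, hge⟩ := exists_monoMap_eq hlow
      have heg : e + g = 0 := by
        refine ih _ (add_mem (Submodule.sum_mem _ fun α hα => Submodule.sum_mem _ fun i hi =>
          Finsupp.single_mem_supported F _ ?_) (Finsupp.supported_mono ?_ hg)) ?_
        · obtain ⟨γ', hγ'⟩ : ∃ γ', α = Finsupp.single i 1 + γ' :=
            ⟨_, mem_support_and_tsub_single_eq_iff.1 ⟨hi, rfl⟩⟩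
          have hdeg := congrArg Finsupp.degree hγ'
          rw [map_add, Finsupp.degree_single] at hdeg
          refine ⟨(hfJ α hα).1.of_le tsub_le_self, ?_⟩
          have h2 := (hfJ α hα).2
          rw [hγ', add_tsub_cancel_left]
          omega
        · exact fun β hβ => ⟨hβ.1, by have := hβ.2; omega⟩
        · rw [map_add, hge, hrel]
      have hgγ : g γ = 0 := by
        refine Finsupp.notMem_support_iff.1 fun hγs => ?_
        have h2 : γ.degree + 2 ≤ m := (hg hγs).2
        rw [hγ, map_add, Finsupp.degree_single] at hα₀
        omega
      have heγ : e γ = 0 := by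
        simpa [hgγ] using DFunLike.congr_fun heg γ
      rw [he, sum_single_tsub_apply _ _ fun α hα i => by
        simp [hx, Finsupp.notMem_support_iff.1 hα]] at heγ
      have hsmul : ε (degJ δd γ) mu • ∑ i ∈ f.support.biUnion Finsupp.support,
          (k (Finsupp.single i 1 + γ) i • f (Finsupp.single i 1 + γ)) * d i b = 0 := by
        rw [← heγ, Finset.smul_sum]
        refine Finset.sum_congr rfl fun i _ => ?_
        simp only [hx]
        rw [degJ_single_add, h.bichar.add_left, one_smul, smul_mul_assoc, smul_smul]
        congr 1
        linear_combination -ε (degJ δd γ) mu * k (Finsupp.single i 1 + γ) i * h.bichar.1 (δd i) mu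
      simpa [mulL_apply] using (smul_eq_zero.1 hsmul).resolve_left (h.bichar.ne_zero _ _)
    have hkf := hind _ _ hop i₀ (Finset.mem_biUnion.2 ⟨α₀, hα₀s, hi₀⟩)
    rw [← hγ] at hkf
    exact hne ((smul_eq_zero.1 hkf).resolve_left (hk α₀ (hfJ α₀ hα₀s).1 i₀ hi₀))

end independence

/-! ### Spanning -/

theorem IsColorFamily.AD_le_monoSpan {𝒜 : Γ → Submodule F A} [GradedAlgebra 𝒜] {ε : Γ → Γ → F}
    {δd : I → Γ} {d : I → Module.End F A} (h : IsColorFamily 𝒜 ε δd d)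
    {D : Submodule F (Module.End F A)}
    (hD : ∀ f ∈ D, ∃ (s : Finset I) (c : I → A), f = ∑ i ∈ s, mulL F A (c i) * d i)
    {x : Module.End F A} (hx : x ∈ AD D) : x ∈ monoSpan d Set.univ := by
  suffices hmul : ∀ y ∈ monoSpan d Set.univ, x * y ∈ monoSpan d Set.univ by
    simpa [dpow_zero] using hmul _ (dpow_mem_monoSpan (Set.mem_univ 0))
  induction hx using Algebra.adjoin_induction with
  | mem x hx =>
    intro y hy
    obtain ⟨a, rfl⟩ | hx := hx
    · exact mulL_mul_mem a hy
    · obtain ⟨s, c, rfl⟩ := hD x hx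
      rw [Finset.sum_mul]
      refine Submodule.sum_mem _ fun i _ => ?_
      rw [mul_assoc]
      exact mulL_mul_mem _ (h.d_mul_mem i (fun _ _ => ⟨trivial, trivial⟩) hy)
  | algebraMap r =>
    intro y hy
    rw [← Algebra.smul_def]
    exact Submodule.smul_mem _ _ hy
  | add x x' _ _ hx hx' =>
    intro y hy
    rw [add_mul]
    exact add_mem (hx y hy) (hx' y hy)
  | mul x x' _ _ hx hx' =>
    intro y hy
    rw [mul_assoc]
    exact hx _ (hx' y hy)

theorem stmt_1
    (𝒜 : Γ → Submodule F A) [GradedAlgebra 𝒜] (ε : Γ → Γ → F)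
    (D : Submodule F (Module.End F A))
    (hchar : (2 : F) ≠ 0)
    (hbich : IsBichar ε)
    (hcomm : IsColorComm 𝒜 ε)
    (hDder : D ≤ DerE 𝒜 ε)
    (hDgr : DGraded 𝒜 ε D)
    (hDcc : DColorComm 𝒜 ε D)
    (hDne : D ≠ ⊥)
    (hsimple : GradedDSimple 𝒜 D)
    (d : I → Module.End F A) (δd : I → Γ)
    (hdD : ∀ i, d i ∈ DScr 𝒜 ε D)
    (hdhom : ∀ i, IsColorDer 𝒜 ε (δd i) (d i))
    (hdspan : ∀ f ∈ DScr 𝒜 ε D, ∃ (s : Finset I) (c : I → A),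
      (∀ i, c i ∈ F1 D) ∧ f = ∑ i ∈ s, mulL F A (c i) * d i)
    (hdind : ∀ (s : Finset I) (c : I → A), (∀ i, c i ∈ F1 D) →
      (∑ i ∈ s, mulL F A (c i) * d i) = 0 → ∀ i ∈ s, c i = 0)
    :
    (∀ x ∈ AD D, ∃ (s : Finset (I →₀ ℕ)) (c : (I →₀ ℕ) → A),
        (∀ α ∈ s, inJ ε δd α) ∧ x = ∑ α ∈ s, mulL F A (c α) * dpow d α) ∧
    (∀ (s : Finset (I →₀ ℕ)) (c : (I →₀ ℕ) → A), (∀ α ∈ s, inJ ε δd α) →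
        (∑ α ∈ s, mulL F A (c α) * dpow d α) = 0 → ∀ α ∈ s, c α = 0) ∧
    (∀ α : I →₀ ℕ, inJ ε δd α → dpow d α ≠ 0) ∧
    (∀ (a : A) (α : I →₀ ℕ), inJ ε δd α → mulL F A a * dpow d α = 0 → a = 0) := by
  have hnt : Nontrivial A := by
    by_contra hA
    rw [not_nontrivial_iff_subsingleton] at hA
    exact hDne (Subsingleton.elim _ _)
  have hfam : IsColorFamily 𝒜 ε δd d :=
    ⟨hbich, hdhom, fun i j =>
      F1D_mul_comm hbich hcomm hDgr hDcc (hdD i).1 (hdhom i).1 (hdD j).1 (hdhom j).1⟩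
  have hDd : ∀ δ, ∀ f ∈ D, IsColorDer 𝒜 ε δ f → ∀ i, f * d i = ε δ (δd i) • (d i * f) := by
    intro δ f hf hfδ i
    exact F1D_mul_comm hbich hcomm hDgr hDcc (Algebra.subset_adjoin (Or.inr hf)) hfδ.1
      (hdD i).1 (hdhom i).1
  have hp : ∀ i, ε (δd i) (δd i) = 1 → ringChar F ≠ 0 → ∃ (s : Finset I) (c : I → A),
      d i ^ ringChar F = ∑ j ∈ s, mulL F A (c j) * d j := by
    intro i heven hchar0
    have : Fact (ringChar F).Prime :=
      ⟨(CharP.char_is_prime_or_zero F (ringChar F)).resolve_right hchar0⟩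
    obtain ⟨s, c, -, hsc⟩ := hdspan (d i ^ ringChar F)
      ⟨pow_mem (hdD i).1 _, Submodule.subset_span ⟨_, (hdhom i).pow_prime hbich heven _⟩⟩
    exact ⟨s, c, hsc⟩
  have hred := hfam.dpow_mem_inJ hchar hp
  have hindep : ∀ (s : Finset (I →₀ ℕ)) (c : (I →₀ ℕ) → A), (∀ α ∈ s, inJ ε δd α) →
      (∑ α ∈ s, mulL F A (c α) * dpow d α) = 0 → ∀ α ∈ s, c α = 0 := by
    intro s c hs hc α hα
    have hf0 : ∑ β ∈ s, Finsupp.single β (c β) = 0 := by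
      refine hfam.monoMap_injective hcomm hred
        (linearIndependent_over_algebra hbich hDgr hsimple (fun i => (hdhom i).1) hDd hdind)
        (s.sup Finsupp.degree + 1) _ (Submodule.sum_mem _ fun β hβ =>
          Finsupp.single_mem_supported F _ ⟨hs β hβ, Nat.lt_succ_of_le (Finset.le_sup hβ)⟩) ?_
      simpa only [map_sum, monoMap_single] using hc
    have hα0 := DFunLike.congr_fun hf0 α
    rw [Finsupp.finsetSum_apply, Finset.sum_eq_single_of_mem α hα fun β _ hβ =>
      Finsupp.single_eq_of_ne' hβ] at hα0
    simpa using hα0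
  have hfaith : ∀ (a : A) (α : I →₀ ℕ), inJ ε δd α → mulL F A a * dpow d α = 0 → a = 0 :=
    fun a α hα h0 => hindep {α} (fun _ => a) (by simpa using hα) (by simpa using h0) α (by simp)
  refine ⟨fun x hx => ?_, hindep, fun α hα h0 => ?_, hfaith⟩
  · have hxspan := hfam.AD_le_monoSpan (fun f hf => by
      obtain ⟨s, c, -, hsc⟩ := hdspan f ⟨Algebra.subset_adjoin (Or.inr hf), hDder hf⟩
      exact ⟨s, c, hsc⟩) hx
    have hle : monoSpan d Set.univ ≤ monoSpan d {β | inJ ε δd β} :=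
      monoSpan_le fun β _ => monoSpan_mono (fun _ hβ => hβ.1) (hred β)
    obtain ⟨f, hf, rfl⟩ := exists_monoMap_eq (hle hxspan)
    exact ⟨f.support, f, fun α hα => hf hα, monoMap_apply d f⟩
  · exact one_ne_zero (hfaith 1 α hα (by rw [h0, mul_zero]))
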